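/- Let 0 < β < 1 and let Λ : [0,∞) → [0,∞) be a continuously differentiable nondecreasing function with Λ(0) = 0 satisfying: (i) Λ(x) → ∞ as x → ∞, and (ii) there is a constant c > 0 such that Λ'(x)/Λ(x) = c/x + O(1/(x log x)) as x → ∞. Define the marginal probabilities P_β(n,t) = ∫_0^∞ e^{-Λ(z t^β)} Λ(z t^β)^n / n! · M_β(z) dz. Fix z₀ > 0. Then along any sequence of pairs (n, t) with n a positive integer, t > 0, n = Λ(z₀ t^β), and n → ∞ (equivalently t → ∞), one has n · P_β(n,t) → (z₀/c) · M_β(z₀). -/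

import Mathlib

open MeasureTheory Filter Real Asymptotics

/-- The M-Wright (Mainardi) function
`M_β(z) = (1/π) ∑_{j=1}^∞ (−z)^{j−1}/(j−1)! · Γ(βj) · sin(πβj)`
(here indexed by `j : ℕ` starting at `0`, corresponding to `j-1` in the series). -/
noncomputable def mWright (β z : ℝ) : ℝ :=
  (1 / π) * ∑' j : ℕ, (-z) ^ j / (Nat.factorial j : ℝ) *
    Real.Gamma (β * (j + 1)) * Real.sin (π * β * (j + 1))

/-- The Hankel-type integrand of the M-Wright function along the rays `r * exp (± i φ)`. -/
noncomputable def mWrightKernel (β φ z r : ℝ) : ℂ :=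
  ((r ^ (β - 1) : ℝ) : ℂ) * Complex.exp ((β * φ : ℝ) * Complex.I) *
    Complex.exp (r * Complex.exp (φ * Complex.I) -
      z * (r ^ β : ℝ) * Complex.exp ((β * φ : ℝ) * Complex.I))

lemma norm_mWrightKernel (β φ z : ℝ) {r : ℝ} (hr : 0 < r) :
    ‖mWrightKernel β φ z r‖ =
      r ^ (β - 1) * exp (r * cos φ - z * r ^ β * cos (β * φ)) := by
  have h1 : ∀ x : ℝ, (Complex.exp (x * Complex.I)).re = cos x := Complex.exp_ofReal_mul_I_re
  rw [mWrightKernel, norm_mul, norm_mul, Complex.norm_exp_ofReal_mul_I, Complex.norm_exp,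
    Complex.norm_real, norm_of_nonneg (rpow_pos_of_pos hr _).le, mul_one, Complex.sub_re,
    Complex.re_ofReal_mul, h1, ← Complex.ofReal_mul, Complex.re_ofReal_mul, h1]

lemma measurable_mWrightKernel (β φ z : ℝ) : Measurable (mWrightKernel β φ z) := by
  unfold mWrightKernel
  fun_prop

/-- A function `exp (b r^β) r^(β-1) exp (-a r)` with `0 < β < 1` is integrable on `(0, ∞)`. -/
lemma integrableOn_exp_rpow_mul {β : ℝ} (hβ0 : 0 < β) (hβ1 : β < 1) {a b : ℝ} (ha : 0 < a)
    (hb : 0 ≤ b) :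
    IntegrableOn (fun r : ℝ => exp (b * r ^ β) * (r ^ (β - 1) * exp (-a * r))) (Set.Ioi 0) := by
  obtain ⟨K, hK0, hK⟩ : ∃ K : ℝ, 0 < K ∧ b * K ^ (β - 1) ≤ a / 2 := by
    have h := (tendsto_rpow_neg_atTop (sub_pos.2 hβ1)).const_mul b
    rw [mul_zero] at h
    obtain ⟨K, h1, h2⟩ := ((h.eventually (eventually_le_nhds (half_pos ha))).and
      (eventually_gt_atTop 0)).exists
    exact ⟨K, h2, by simpa using h1⟩
  have hint : IntegrableOn (fun r : ℝ => r ^ (β - 1) * exp (-(a / 2) * r ^ (1 : ℝ)))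
      (Set.Ioi 0) :=
    integrableOn_rpow_mul_exp_neg_mul_rpow (by linarith) one_pos (half_pos ha)
  refine Integrable.mono' (hint.const_mul (exp (b * K ^ β))) (by fun_prop) ?_
  filter_upwards [ae_restrict_mem measurableSet_Ioi] with r hr
  have hr0 : 0 < r := hr
  have hp := rpow_pos_of_pos hr0 (β - 1)
  have key : b * r ^ β ≤ b * K ^ β + a / 2 * r := by
    rcases le_total r K with h | h
    · have := mul_le_mul_of_nonneg_left (rpow_le_rpow hr0.le h hβ0.le) hb
      nlinarith
    · have h1 : r ^ β = r ^ (β - 1) * r := by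
        rw [← rpow_add_one hr0.ne']; ring_nf
      have h2 := rpow_le_rpow_of_nonpos hK0 h (by linarith : β - 1 ≤ 0)
      have h3 := mul_le_mul_of_nonneg_left h2 hb
      have h4 := mul_nonneg hb (rpow_pos_of_pos hK0 β).le
      have h5 : b * r ^ (β - 1) * r ≤ a / 2 * r :=
        mul_le_mul_of_nonneg_right (h3.trans hK) hr0.le
      rw [h1]
      linarith
  rw [norm_of_nonneg (by positivity), rpow_one]
  calc exp (b * r ^ β) * (r ^ (β - 1) * exp (-a * r))
      = r ^ (β - 1) * exp (b * r ^ β + -a * r) := by rw [exp_add]; ring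
    _ ≤ r ^ (β - 1) * exp (b * K ^ β + -(a / 2) * r) := by
        gcongr _ * exp ?_
        linarith
    _ = _ := by rw [exp_add]; ring

lemma integrableOn_rpow_sub_one_mul_exp_neg {β a : ℝ} (hβ : 0 < β) (ha : 0 < a) :
    IntegrableOn (fun r : ℝ => r ^ (β - 1) * exp (-a * r)) (Set.Ioi 0) := by
  simpa using integrableOn_rpow_mul_exp_neg_mul_rpow (s := β - 1) (by linarith) one_pos ha

/-- The Gamma integral with a complex rate `-w` in the right half-plane. -/
lemma integral_rpow_mul_cexp_of_re_neg {a : ℝ} (ha : 0 < a) {w : ℂ} (hw : w.re < 0) :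
    ∫ r in Set.Ioi (0 : ℝ), ((r ^ (a - 1) : ℝ) : ℂ) * Complex.exp (w * r) =
      (-w) ^ (-(a : ℂ)) * (Gamma a : ℝ) := by
  set μ : Measure ℝ := (volume.restrict (Set.Ioi (0 : ℝ))).withDensity
    (fun r => ENNReal.ofReal (r ^ (a - 1))) with hμ
  have hmeas : Measurable fun r : ℝ => ENNReal.ofReal (r ^ (a - 1)) := by fun_prop
  have hfin : ∀ᵐ r ∂(volume.restrict (Set.Ioi (0 : ℝ))), ENNReal.ofReal (r ^ (a - 1)) < ⊤ :=
    .of_forall fun r => ENNReal.ofReal_lt_top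
  have hmgf : ∀ w : ℂ, ProbabilityTheory.complexMGF id μ w =
      ∫ r in Set.Ioi (0 : ℝ), ((r ^ (a - 1) : ℝ) : ℂ) * Complex.exp (w * r) := by
    intro w
    rw [ProbabilityTheory.complexMGF, hμ, integral_withDensity_eq_integral_toReal_smul hmeas hfin]
    refine setIntegral_congr_fun measurableSet_Ioi fun r hr => ?_
    have hr0 : 0 < r := hr
    simp only [id, ENNReal.toReal_ofReal (rpow_pos_of_pos hr0 _).le, Complex.real_smul]
  have hset : Set.Iio 0 ⊆ ProbabilityTheory.integrableExpSet id μ := by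
    intro x hx
    have hx0 : 0 < -x := neg_pos.2 hx
    change Integrable (fun r : ℝ => exp (x * id r)) μ
    rw [hμ, integrable_withDensity_iff_integrable_smul' hmeas hfin]
    refine (integrableOn_rpow_sub_one_mul_exp_neg ha hx0).congr_fun (fun r hr => ?_)
      measurableSet_Ioi
    have hr0 : 0 < r := hr
    simp [ENNReal.toReal_ofReal (rpow_pos_of_pos hr0 _).le]
  have hopen : IsOpen {w : ℂ | w.re < 0} := isOpen_lt Complex.continuous_re continuous_const
  have hX : AnalyticOnNhd ℂ (ProbabilityTheory.complexMGF id μ) {w | w.re < 0} :=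
    ProbabilityTheory.analyticOnNhd_complexMGF.mono fun w hw =>
      interior_maximal hset isOpen_Iio hw
  have hY : AnalyticOnNhd ℂ (fun w : ℂ => (-w) ^ (-(a : ℂ)) * (Gamma a : ℝ)) {w | w.re < 0} := by
    refine DifferentiableOn.analyticOnNhd (fun w hw => ?_) hopen
    have hw' : -w ∈ Complex.slitPlane := Or.inl (by simpa using hw)
    exact ((differentiableAt_id.neg.cpow (differentiableAt_const _) hw').mul_const
      _).differentiableWithinAt
  have hpre : IsPreconnected {w : ℂ | w.re < 0} := (convex_halfSpace_re_lt 0).isPreconnected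
  have hEq : ∀ᶠ x : ℝ in nhds (-1), ProbabilityTheory.complexMGF id μ x =
      (-(x : ℂ)) ^ (-(a : ℂ)) * (Gamma a : ℝ) := by
    filter_upwards [Iio_mem_nhds (by norm_num : (-1 : ℝ) < 0)] with x hx
    have hx0 : 0 < -x := neg_pos.2 hx
    have h := integral_rpow_mul_exp_neg_mul_Ioi ha hx0
    rw [hmgf]
    calc _ = ∫ r in Set.Ioi (0 : ℝ), ((r ^ (a - 1) * exp (-(-x * r)) : ℝ) : ℂ) := by
          simp
      _ = _ := by
          rw [integral_complex_ofReal, h, one_div, inv_rpow hx0.le, ← rpow_neg hx0.le]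
          push_cast [Complex.ofReal_cpow hx0.le]
          rfl
  have hfreq : ∃ᶠ z in nhdsWithin (-1 : ℂ) {-1}ᶜ, ProbabilityTheory.complexMGF id μ z =
      (-z) ^ (-(a : ℂ)) * (Gamma a : ℝ) := by
    have h1 : Tendsto (fun x : ℝ => (x : ℂ)) (nhdsWithin (-1) {-1}ᶜ)
        (nhdsWithin (-1 : ℂ) {-1}ᶜ) := by
      refine tendsto_nhdsWithin_iff.2 ⟨?_, ?_⟩
      · have := (Complex.continuous_ofReal.tendsto (-1)).mono_left
          (nhdsWithin_le_nhds (s := {-1}ᶜ))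
        simpa using this
      · filter_upwards [self_mem_nhdsWithin] with x hx h
        refine hx ?_
        have h' : (x : ℂ) = -1 := h
        exact_mod_cast h'
    exact h1.frequently (hEq.filter_mono nhdsWithin_le_nhds).frequently
  rw [← hmgf]
  exact hX.eqOn_of_preconnected_of_frequently_eq hY hpre (z₀ := -1) (by simp) hfreq hw

lemma integral_cpow_mul_exp_ray {a φ : ℝ} (ha : 0 < a) (hφ : π / 2 < φ) (hφ' : φ < π) :
    ∫ r in Set.Ioi (0 : ℝ), ((r ^ (a - 1) : ℝ) : ℂ) * Complex.exp (a * φ * Complex.I) *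
        Complex.exp (r * Complex.exp (φ * Complex.I)) =
      Complex.exp (π * a * Complex.I) * (Gamma a : ℝ) := by
  have hw : -Complex.exp (φ * Complex.I) = Complex.exp (-((π - φ) * Complex.I)) := by
    rw [show -((π - φ) * Complex.I) = φ * Complex.I - π * Complex.I by ring, Complex.exp_sub,
      Complex.exp_pi_mul_I]; ring
  have hre : (Complex.exp (φ * Complex.I)).re < 0 := by
    rw [Complex.exp_ofReal_mul_I_re]
    exact cos_neg_of_pi_div_two_lt_of_lt hφ (by linarith [pi_pos])
  have h := integral_rpow_mul_cexp_of_re_neg ha hre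
  have hpow : (-Complex.exp (φ * Complex.I)) ^ (-(a : ℂ)) =
      Complex.exp ((π - φ) * a * Complex.I) := by
    rw [hw, Complex.cpow_def_of_ne_zero (Complex.exp_ne_zero _), Complex.log_exp]
    · ring_nf
    · simp; linarith [pi_pos]
    · simp; linarith [pi_pos]
  rw [hpow] at h
  calc _ = ∫ r in Set.Ioi (0 : ℝ), Complex.exp (a * φ * Complex.I) *
        (((r ^ (a - 1) : ℝ) : ℂ) * Complex.exp (Complex.exp (φ * Complex.I) * r)) := by
        congr 1 with r
        rw [mul_comm (r : ℂ) (Complex.exp _)]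
        ring
    _ = _ := by
        rw [integral_const_mul, h, ← mul_assoc, ← Complex.exp_add]
        ring_nf

lemma mWright_eq_integral {β φ : ℝ} (hβ0 : 0 < β) (hβ1 : β < 1) (hφ : π / 2 < φ) (hφ' : φ < π)
    (z : ℝ) :
    mWright β z = (1 / π) * (∫ r in Set.Ioi (0 : ℝ), mWrightKernel β φ z r).im := by
  have hcos : 0 < -cos φ := by
    have := cos_neg_of_pi_div_two_lt_of_lt hφ (by linarith [pi_pos])
    linarith
  set w := Complex.exp (φ * Complex.I) with hw
  set v := Complex.exp ((β * φ : ℝ) * Complex.I) with hv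
  have hwre : w.re = cos φ := Complex.exp_ofReal_mul_I_re φ
  let F : ℕ → ℝ → ℂ := fun j r => (((-z) ^ j / (j.factorial : ℝ) : ℝ) : ℂ) *
    (((r ^ (β * (j + 1) - 1) : ℝ) : ℂ) * Complex.exp (((β * (j + 1) : ℝ) : ℂ) * φ * Complex.I) *
      Complex.exp (r * w))
  let bound : ℕ → ℝ → ℝ := fun j r =>
    (|z| * r ^ β) ^ j / j.factorial * (r ^ (β - 1) * exp (-(-cos φ) * r))
  have hpow : ∀ (j : ℕ) {r : ℝ}, 0 < r → r ^ (β * (j + 1) - 1) = (r ^ β) ^ j * r ^ (β - 1) := by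
    intro j r hr
    rw [← rpow_natCast, ← rpow_mul hr.le, ← rpow_add hr]; ring_nf
  have hbs : ∀ r, HasSum (fun j => bound j r)
      (exp (|z| * r ^ β) * (r ^ (β - 1) * exp (-(-cos φ) * r))) := by
    intro r
    have := NormedSpace.expSeries_div_hasSum_exp (|z| * r ^ β)
    rw [← Real.exp_eq_exp_ℝ] at this
    exact this.mul_right _
  have hsum : HasSum (fun j => ∫ r in Set.Ioi (0 : ℝ), F j r)
      (∫ r in Set.Ioi (0 : ℝ), mWrightKernel β φ z r) := by
    refine hasSum_integral_of_dominated_convergence bound ?_ ?_ ?_ ?_ ?_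
    · intro j
      refine Measurable.aestronglyMeasurable ?_
      fun_prop
    · intro j
      filter_upwards [ae_restrict_mem measurableSet_Ioi] with r hr
      have hr0 : 0 < r := hr
      refine le_of_eq ?_
      have h1 : ‖Complex.exp (((β * (j + 1) : ℝ) : ℂ) * φ * Complex.I)‖ = 1 := by
        rw [← Complex.ofReal_mul, Complex.norm_exp_ofReal_mul_I]
      simp only [F, bound]
      rw [norm_mul, norm_mul, norm_mul, h1, Complex.norm_exp, Complex.re_ofReal_mul, hwre,
        Complex.norm_real, Complex.norm_real, norm_of_nonneg (rpow_pos_of_pos hr0 _).le,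
        hpow j hr0, norm_div, norm_pow, norm_neg, Real.norm_eq_abs, mul_pow,
        norm_of_nonneg (Nat.cast_nonneg _), show -(-cos φ) * r = r * cos φ by ring]
      ring
    · exact .of_forall fun r => (hbs r).summable
    · simp_rw [fun r => (hbs r).tsum_eq]
      exact integrableOn_exp_rpow_mul hβ0 hβ1 hcos (abs_nonneg z)
    · filter_upwards [ae_restrict_mem measurableSet_Ioi] with r hr
      have hr0 : 0 < r := hr
      have h := NormedSpace.expSeries_div_hasSum_exp (-(z * (r ^ β : ℝ) * v))
      rw [← Complex.exp_eq_exp_ℂ] at h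
      have h2 := h.mul_right (((r ^ (β - 1) : ℝ) : ℂ) * v * Complex.exp (r * w))
      have h4 : mWrightKernel β φ z r = Complex.exp (-(z * (r ^ β : ℝ) * v)) *
          (((r ^ (β - 1) : ℝ) : ℂ) * v * Complex.exp (r * w)) := by
        unfold mWrightKernel
        rw [sub_eq_add_neg (_ * _) (_ * _), Complex.exp_add]
        ring
      have h5 : (fun j => F j r) = fun j => (-(z * (r ^ β : ℝ) * v)) ^ j / (j.factorial : ℂ) *
          (((r ^ (β - 1) : ℝ) : ℂ) * v * Complex.exp (r * w)) := by
        funext j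
        have h3 : Complex.exp (((β * (j + 1) : ℝ) : ℂ) * φ * Complex.I) = v ^ j * v := by
          rw [← pow_succ, hv, ← Complex.exp_nat_mul]
          push_cast; ring_nf
        simp only [F]
        rw [h3, hpow j hr0]
        push_cast
        rw [show -(z * ((r ^ β : ℝ) : ℂ) * v) = (-z) * (r ^ β : ℝ) * v by ring, mul_pow, mul_pow]
        ring
      rw [h4, h5]
      exact h2
  have him := Complex.hasSum_im hsum
  rw [mWright, ← him.tsum_eq]
  congr 2
  funext j
  have hpos : 0 < β * ((j : ℝ) + 1) := by positivity
  simp only [F]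
  rw [integral_const_mul, integral_cpow_mul_exp_ray hpos hφ hφ', Complex.im_ofReal_mul, mul_comm
    (Complex.exp _), Complex.im_ofReal_mul, ← Complex.ofReal_mul, Complex.exp_ofReal_mul_I_im]
  ring_nf

/-- On the positive half-line the M-Wright function is bounded and continuous, and it is
`O(1 / z)`. -/
lemma mWright_bounds {β : ℝ} (hβ0 : 0 < β) (hβ1 : β < 1) :
    ∃ B, 0 ≤ B ∧ (∀ z, 0 < z → |mWright β z| ≤ B) ∧ (∀ z, 0 < z → |z * mWright β z| ≤ B) ∧
      ContinuousOn (mWright β) (Set.Ioi 0) := by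
  obtain ⟨φ, hφ, hφ', hφβ⟩ : ∃ φ, π / 2 < φ ∧ φ < π ∧ β * φ < π / 2 := by
    refine ⟨π / (1 + β), ?_, ?_, ?_⟩
    · rw [div_lt_div_iff₀ two_pos (by linarith)]; nlinarith [pi_pos]
    · rw [div_lt_iff₀ (by linarith)]; nlinarith [pi_pos]
    · rw [← mul_div_assoc, div_lt_div_iff₀ (by linarith) two_pos]; nlinarith [pi_pos]
  have ha : 0 < -cos φ := by
    have := cos_neg_of_pi_div_two_lt_of_lt hφ (by linarith [pi_pos])
    linarith
  have hd : 0 < cos (β * φ) := cos_pos_of_mem_Ioo ⟨by nlinarith [pi_pos], hφβ⟩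
  have habs : ∀ z, |mWright β z| ≤ ‖∫ r in Set.Ioi (0 : ℝ), mWrightKernel β φ z r‖ := by
    intro z
    rw [mWright_eq_integral hβ0 hβ1 hφ hφ' z, abs_mul]
    have h1 : |1 / π| ≤ 1 := by
      rw [abs_of_pos (by positivity), div_le_one pi_pos]; linarith [pi_gt_three]
    calc _ ≤ 1 * _ := mul_le_mul_of_nonneg_right h1 (abs_nonneg _)
      _ ≤ _ := by rw [one_mul]; exact Complex.abs_im_le_norm _
  have hle : ∀ z, 0 < z → ∀ r ∈ Set.Ioi (0 : ℝ),
      ‖mWrightKernel β φ z r‖ ≤ r ^ (β - 1) * exp (-(-cos φ) * r) := by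
    intro z hz r hr
    have hr0 : 0 < r := hr
    rw [norm_mWrightKernel β φ z hr0]
    have : 0 ≤ z * r ^ β * cos (β * φ) := by positivity
    gcongr
    linarith
  have hle' : ∀ z, 0 < z → ∀ r ∈ Set.Ioi (0 : ℝ),
      ‖mWrightKernel β φ z r‖ ≤ r ^ (β - 1) * exp (-(z * cos (β * φ)) * r ^ β) := by
    intro z hz r hr
    have hr0 : 0 < r := hr
    rw [norm_mWrightKernel β φ z hr0]
    gcongr
    nlinarith [mul_pos hr0 ha]
  have hint := integrableOn_rpow_sub_one_mul_exp_neg hβ0 ha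
  have hI0 : 0 ≤ ∫ r in Set.Ioi (0 : ℝ), r ^ (β - 1) * exp (-(-cos φ) * r) :=
    setIntegral_nonneg measurableSet_Ioi fun r hr => by
      have hr0 : 0 < r := hr
      positivity
  have hB0 : 0 ≤ 1 / (cos (β * φ) * β) := by positivity
  refine ⟨(∫ r in Set.Ioi (0 : ℝ), r ^ (β - 1) * exp (-(-cos φ) * r)) +
    1 / (cos (β * φ) * β), by positivity, fun z hz => ?_, fun z hz => ?_, ?_⟩
  · have h1 := norm_integral_le_of_norm_le hint
      (f := mWrightKernel β φ z)
      ((ae_restrict_mem measurableSet_Ioi).mono (hle z hz))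
    linarith [habs z]
  · have hzd : 0 < z * cos (β * φ) := by positivity
    have hint' := integrableOn_rpow_mul_exp_neg_mul_rpow (s := β - 1) (by linarith) hβ0 hzd
    have h1 := norm_integral_le_of_norm_le hint'
      (f := mWrightKernel β φ z)
      ((ae_restrict_mem measurableSet_Ioi).mono (hle' z hz))
    rw [integral_rpow_mul_exp_neg_mul_rpow hβ0 (by linarith) hzd, sub_add_cancel,
      neg_div, div_self hβ0.ne', rpow_neg_one, Gamma_one] at h1
    rw [abs_mul, abs_of_pos hz]
    calc z * |mWright β z| ≤ z * ((z * cos (β * φ))⁻¹ * (1 / β) * 1) :=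
          mul_le_mul_of_nonneg_left ((habs z).trans h1) hz.le
      _ = 1 / (cos (β * φ) * β) := by field_simp
      _ ≤ _ := by linarith
  · have hc : ContinuousOn (fun z => ∫ r in Set.Ioi (0 : ℝ), mWrightKernel β φ z r)
        (Set.Ioi 0) := by
      refine continuousOn_of_dominated (bound := fun r => r ^ (β - 1) * exp (-(-cos φ) * r))
        (fun z _ => (measurable_mWrightKernel β φ z).aestronglyMeasurable)
        (fun z hz => (ae_restrict_mem measurableSet_Ioi).mono (hle z hz)) hint ?_
      refine .of_forall fun r => Continuous.continuousOn ?_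
      unfold mWrightKernel
      fun_prop
    have := (Complex.continuous_im.comp_continuousOn hc).const_smul (1 / π)
    exact this.congr fun z _ => mWright_eq_integral hβ0 hβ1 hφ hφ' z

lemma hasDerivAt_exp_neg_mul_sum_pow_div_factorial (m : ℕ) (y : ℝ) :
    HasDerivAt (fun y => -(exp (-y) * ∑ i ∈ Finset.range (m + 1), y ^ i / i.factorial))
      (exp (-y) * y ^ m / m.factorial) y := by
  have hexp : HasDerivAt (fun y : ℝ => exp (-y)) (-exp (-y)) y := by
    simpa using (hasDerivAt_neg y).exp
  induction m with
  | zero =>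
    refine (hexp.neg.congr_deriv (by simp)).congr_of_eventuallyEq (.of_forall fun y => ?_)
    simp
  | succ m ih =>
    have hpow : HasDerivAt (fun y : ℝ => y ^ (m + 1) / ((m + 1).factorial : ℝ))
        (y ^ m / m.factorial) y := by
      refine ((hasDerivAt_pow (m + 1) y).div_const ((m + 1).factorial : ℝ)).congr_deriv ?_
      rw [Nat.factorial_succ]
      push_cast
      field_simp
    refine ((ih.sub (hexp.mul hpow)).congr_deriv (by ring)).congr_of_eventuallyEq
      (.of_forall fun y => ?_)
    simp only [Pi.sub_apply, Pi.mul_apply]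
    rw [Finset.sum_range_succ _ (m + 1)]
    ring

lemma tendsto_exp_neg_mul_sum_pow_div_factorial (m : ℕ) :
    Tendsto (fun y : ℝ => -(exp (-y) * ∑ i ∈ Finset.range (m + 1), y ^ i / i.factorial))
      atTop (nhds 0) := by
  have h : Tendsto (fun y : ℝ => -∑ i ∈ Finset.range (m + 1),
      (y ^ i * exp (-y)) * ((i.factorial : ℝ)⁻¹)) atTop
      (nhds (-∑ i ∈ Finset.range (m + 1), 0 * ((i.factorial : ℝ)⁻¹))) :=
    (tendsto_finsetSum _ fun i _ =>
      (tendsto_pow_mul_exp_neg_atTop_nhds_zero i).mul_const _).neg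
  simp only [zero_mul, Finset.sum_const_zero, neg_zero] at h
  refine h.congr fun y => ?_
  rw [Finset.mul_sum]
  congr 1
  exact Finset.sum_congr rfl fun i _ => by ring

/-- The pull-back under `z ↦ Λ (z * s)` of the Gamma density with shape `m + 1`. -/
noncomputable def gammaPullback (Λ Λ' : ℝ → ℝ) (s : ℝ) (m : ℕ) (z : ℝ) : ℝ :=
  exp (-Λ (z * s)) * Λ (z * s) ^ m / m.factorial * (Λ' (z * s) * s)

section Pullback

variable {Λ Λ' : ℝ → ℝ} {s : ℝ}

lemma nonneg_deriv_of_monotoneOn_Ici (hmono : MonotoneOn Λ (Set.Ici (0 : ℝ)))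
    (hderiv : ∀ x, 0 ≤ x → HasDerivAt Λ (Λ' x) x) {x : ℝ} (hx : 0 ≤ x) : 0 ≤ Λ' x := by
  rw [← (hderiv x hx).hasDerivWithinAt.derivWithin (uniqueDiffOn_Ici 0 x hx)]
  exact hmono.derivWithin_nonneg

lemma gammaPullback_nonneg (hpos : ∀ x, 0 ≤ x → 0 ≤ Λ x)
    (hmono : MonotoneOn Λ (Set.Ici (0 : ℝ)))
    (hderiv : ∀ x, 0 ≤ x → HasDerivAt Λ (Λ' x) x) (hs : 0 < s) (m : ℕ) {z : ℝ} (hz : 0 ≤ z) :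
    0 ≤ gammaPullback Λ Λ' s m z := by
  have h0 : 0 ≤ z * s := by positivity
  have h1 := hpos _ h0
  have h2 := nonneg_deriv_of_monotoneOn_Ici hmono hderiv h0
  unfold gammaPullback
  positivity

lemma integral_gammaPullback (hpos : ∀ x, 0 ≤ x → 0 ≤ Λ x) (h0 : Λ 0 = 0)
    (hmono : MonotoneOn Λ (Set.Ici (0 : ℝ)))
    (hderiv : ∀ x, 0 ≤ x → HasDerivAt Λ (Λ' x) x) (hinf : Tendsto Λ atTop atTop)
    (hs : 0 < s) (m : ℕ) :
    IntegrableOn (gammaPullback Λ Λ' s m) (Set.Ioi 0) ∧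
      ∫ z in Set.Ioi 0, gammaPullback Λ Λ' s m z = 1 := by
  set G : ℝ → ℝ := fun y => -(exp (-y) * ∑ i ∈ Finset.range (m + 1), y ^ i / i.factorial) with hG
  have hd : ∀ z ∈ Set.Ici (0 : ℝ),
      HasDerivAt (fun z => G (Λ (z * s))) (gammaPullback Λ Λ' s m z) z := by
    intro z hz
    have hzs : 0 ≤ z * s := mul_nonneg hz hs.le
    have h1 : HasDerivAt (fun z => Λ (z * s)) (Λ' (z * s) * s) z := by
      have := (hderiv _ hzs).comp z ((hasDerivAt_id z).mul_const s)
      simpa [Function.comp_def] using this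
    exact HasDerivAt.comp (h₂ := G) z
      (hasDerivAt_exp_neg_mul_sum_pow_div_factorial m (Λ (z * s))) h1
  have hnn : ∀ z ∈ Set.Ioi (0 : ℝ), 0 ≤ gammaPullback Λ Λ' s m z := fun z hz =>
    gammaPullback_nonneg hpos hmono hderiv hs m (le_of_lt hz)
  have hlim : Tendsto (fun z => G (Λ (z * s))) atTop (nhds 0) :=
    (tendsto_exp_neg_mul_sum_pow_div_factorial m).comp
      (hinf.comp (tendsto_id.atTop_mul_const hs))
  refine ⟨integrableOn_Ioi_deriv_of_nonneg' hd hnn hlim, ?_⟩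
  rw [integral_Ioi_of_hasDerivAt_of_nonneg' hd hnn hlim]
  simp [hG, h0, Finset.sum_range_succ']

lemma integral_sq_sub_mul_gammaPullback (hpos : ∀ x, 0 ≤ x → 0 ≤ Λ x) (h0 : Λ 0 = 0)
    (hmono : MonotoneOn Λ (Set.Ici (0 : ℝ)))
    (hderiv : ∀ x, 0 ≤ x → HasDerivAt Λ (Λ' x) x) (hinf : Tendsto Λ atTop atTop)
    (hs : 0 < s) (m : ℕ) :
    IntegrableOn (fun z => (Λ (z * s) - (m + 1)) ^ 2 * gammaPullback Λ Λ' s m z) (Set.Ioi 0) ∧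
      ∫ z in Set.Ioi 0, (Λ (z * s) - (m + 1)) ^ 2 * gammaPullback Λ Λ' s m z = (m : ℝ) + 1 := by
  have key := fun j => integral_gammaPullback hpos h0 hmono hderiv hinf hs j
  have heq : (fun z => (Λ (z * s) - (m + 1)) ^ 2 * gammaPullback Λ Λ' s m z) =
      fun z => (m + 1) * (m + 2) * gammaPullback Λ Λ' s (m + 2) z -
        2 * (m + 1) ^ 2 * gammaPullback Λ Λ' s (m + 1) z +
        (m + 1) ^ 2 * gammaPullback Λ Λ' s m z := by
    funext z
    simp only [gammaPullback, Nat.factorial_succ]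
    push_cast
    field_simp
    ring
  have i1 := (key (m + 2)).1.const_mul (((m : ℝ) + 1) * (m + 2))
  have i2 := (key (m + 1)).1.const_mul (2 * ((m : ℝ) + 1) ^ 2)
  have i3 := (key m).1.const_mul (((m : ℝ) + 1) ^ 2)
  have i12 : IntegrableOn (fun z => ((m : ℝ) + 1) * (m + 2) * gammaPullback Λ Λ' s (m + 2) z -
      2 * ((m : ℝ) + 1) ^ 2 * gammaPullback Λ Λ' s (m + 1) z) (Set.Ioi 0) := i1.sub i2
  rw [heq]
  refine ⟨i12.add i3, ?_⟩
  rw [integral_add i12 i3, integral_sub i1 i2, integral_const_mul, integral_const_mul,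
    integral_const_mul, (key _).2, (key _).2, (key _).2]
  ring

/-- A pointwise comparison of `f` with a multiple of the pulled-back Gamma density controls the
integral of `f`. -/
lemma abs_integral_sub_le_of_gammaPullback (hpos : ∀ x, 0 ≤ x → 0 ≤ Λ x) (h0 : Λ 0 = 0)
    (hmono : MonotoneOn Λ (Set.Ici (0 : ℝ)))
    (hderiv : ∀ x, 0 ≤ x → HasDerivAt Λ (Λ' x) x) (hinf : Tendsto Λ atTop atTop)
    (hs : 0 < s) (m : ℕ) {f : ℝ → ℝ} {l ε C a E : ℝ} (ha : 0 ≤ a)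
    (hf : AEStronglyMeasurable f (volume.restrict (Set.Ioi 0)))
    (hle : ∀ z, 0 < z → |f z - l * gammaPullback Λ Λ' s m z| ≤
      ε * gammaPullback Λ Λ' s m z +
        C / (m + 1) ^ 2 * ((Λ (z * s) - (m + 1)) ^ 2 * gammaPullback Λ Λ' s m z) +
        (Set.Ioc 0 a).indicator (fun _ => E) z) :
    |(∫ z in Set.Ioi 0, f z) - l| ≤ ε + C / (m + 1) + a * E := by
  obtain ⟨i1, e1⟩ := integral_gammaPullback hpos h0 hmono hderiv hinf hs m
  obtain ⟨i2, e2⟩ := integral_sq_sub_mul_gammaPullback hpos h0 hmono hderiv hinf hs m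
  have i3 : IntegrableOn ((Set.Ioc 0 a).indicator fun _ => E) (Set.Ioi (0 : ℝ)) := by
    refine Integrable.integrableOn ((integrable_indicator_iff measurableSet_Ioc).2 ?_)
    exact integrableOn_const (by simp)
  have e3 : ∫ z in Set.Ioi (0 : ℝ), (Set.Ioc 0 a).indicator (fun _ => E) z = a * E := by
    rw [setIntegral_indicator measurableSet_Ioc, Set.inter_eq_right.2 Set.Ioc_subset_Ioi_self]
    simp [ha]
  have j12 := (i1.const_mul ε).add (i2.const_mul (C / ((m : ℝ) + 1) ^ 2))
  have jb := j12.add i3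
  have hle' := (ae_restrict_mem (μ := volume) measurableSet_Ioi).mono fun z hz => hle z hz
  have jd : IntegrableOn (fun z => f z - l * gammaPullback Λ Λ' s m z) (Set.Ioi 0) :=
    Integrable.mono' jb (hf.sub (i1.const_mul l).aestronglyMeasurable) hle'
  have jf : IntegrableOn f (Set.Ioi 0) := by
    refine (jd.add (i1.const_mul l)).congr (.of_forall fun z => ?_)
    simp
  have h := norm_integral_le_of_norm_le jb
    (f := fun z => f z - l * gammaPullback Λ Λ' s m z) hle'
  rw [integral_sub jf (i1.const_mul l), integral_const_mul, e1, mul_one] at h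
  refine h.trans (le_of_eq ?_)
  rw [integral_add' j12 i3, integral_add' (i1.const_mul ε) (i2.const_mul _), integral_const_mul,
    integral_const_mul, e1, e2, e3]
  have : (m : ℝ) + 1 ≠ 0 := by positivity
  field_simp

end Pullback

/-- A lower bound on the logarithmic derivative gives power-type growth. -/
lemma rpow_div_mul_le_of_le_logDeriv {Λ Λ' : ℝ → ℝ} {X₀ p : ℝ} (hX₀ : 0 < X₀)
    (hderiv : ∀ x, X₀ ≤ x → HasDerivAt Λ (Λ' x) x) (h : ∀ x, X₀ ≤ x → p * Λ x ≤ x * Λ' x)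
    {a b : ℝ} (ha : X₀ ≤ a) (hab : a ≤ b) : (b / a) ^ p * Λ a ≤ Λ b := by
  have hd : ∀ x, X₀ ≤ x → HasDerivAt (fun x => Λ x * x ^ (-p))
      (Λ' x * x ^ (-p) + Λ x * (-p * x ^ (-p - 1))) x := fun x hx =>
    (hderiv x hx).mul (hasDerivAt_rpow_const (Or.inl (hX₀.trans_le hx).ne'))
  have hmono : MonotoneOn (fun x => Λ x * x ^ (-p)) (Set.Ici X₀) := by
    refine monotoneOn_of_deriv_nonneg (convex_Ici X₀)
      (fun x hx => (hd x hx).continuousAt.continuousWithinAt)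
      (fun x hx => (hd x (interior_subset hx)).differentiableAt.differentiableWithinAt)
      fun x hx => ?_
    have hx' : X₀ ≤ x := interior_subset hx
    have hx0 : 0 < x := hX₀.trans_le hx'
    have h1 : x ^ (-p) = x ^ (-p - 1) * x := by
      rw [← rpow_add_one hx0.ne']; ring_nf
    rw [(hd x hx').deriv, h1]
    have h2 := mul_nonneg (rpow_pos_of_pos hx0 (-p - 1)).le (sub_nonneg.2 (h x hx'))
    linarith
  have hm : Λ a * a ^ (-p) ≤ Λ b * b ^ (-p) := hmono ha (ha.trans hab) hab
  have ha0 : 0 < a := hX₀.trans_le ha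
  have hb0 : 0 < b := ha0.trans_le hab
  rw [rpow_neg ha0.le, rpow_neg hb0.le, ← div_eq_mul_inv, ← div_eq_mul_inv,
    div_le_div_iff₀ (rpow_pos_of_pos ha0 p) (rpow_pos_of_pos hb0 p)] at hm
  rw [div_rpow hb0.le ha0.le, div_mul_eq_mul_div, div_le_iff₀ (rpow_pos_of_pos ha0 p)]
  linarith

lemma tendsto_mul_logDeriv_of_isBigO {Λ Λ' : ℝ → ℝ} {c : ℝ}
    (h : (fun x => Λ' x / Λ x - c / x) =O[atTop] fun x => 1 / (x * Real.log x)) :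
    Tendsto (fun x => x * Λ' x / Λ x) atTop (nhds c) := by
  have h1 : (fun x => x * (Λ' x / Λ x - c / x)) =O[atTop] fun x => x * (1 / (x * Real.log x)) :=
    (isBigO_refl _ _).mul h
  have h2 : Tendsto (fun x : ℝ => x * (1 / (x * Real.log x))) atTop (nhds 0) := by
    refine tendsto_log_atTop.inv_tendsto_atTop.congr' ?_
    filter_upwards [eventually_gt_atTop 0] with x hx
    simp only [Pi.inv_apply]
    field_simp
  have h3 := (h1.trans_tendsto h2).add_const c
  rw [zero_add] at h3
  refine h3.congr' ?_
  filter_upwards [eventually_gt_atTop 0] with x hx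
  field_simp
  ring

/-- Under power-type growth, `Λ (z * s)` is separated from `Λ (z₀ * s)` by a fixed proportion,
uniformly over `z` away from `z₀` and large `s`. -/
lemma exists_mul_le_abs_sub {Λ : ℝ → ℝ} {X₀ p : ℝ} (hp : 0 < p)
    (hpos : ∀ x, 0 ≤ x → 0 ≤ Λ x) (hmono : MonotoneOn Λ (Set.Ici (0 : ℝ)))
    (hgrowth : ∀ a b, X₀ ≤ a → a ≤ b → (b / a) ^ p * Λ a ≤ Λ b)
    {z₀ η : ℝ} (hη : 0 < η) (hηz : η < z₀) :
    ∃ δ, 0 < δ ∧ ∀ s, 0 < s → X₀ ≤ (z₀ - η) * s → ∀ z, 0 < z → η ≤ |z - z₀| →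
      δ * Λ (z₀ * s) ≤ |Λ (z * s) - Λ (z₀ * s)| := by
  have hz₀ : 0 < z₀ := hη.trans hηz
  have hlow : 0 < z₀ - η := sub_pos.2 hηz
  set u := ((z₀ + η) / z₀) ^ p with hu
  set v := (z₀ / (z₀ - η)) ^ p with hv
  have hu1 : 1 < u := one_lt_rpow ((one_lt_div hz₀).2 (by linarith)) hp
  have hv1 : 1 < v := one_lt_rpow ((one_lt_div hlow).2 (by linarith)) hp
  have hvi : v⁻¹ < 1 := inv_lt_one_of_one_lt₀ hv1
  refine ⟨min (u - 1) (1 - v⁻¹), lt_min (by linarith) (by linarith), fun s hs hX z hz hzη => ?_⟩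
  have hn : 0 ≤ Λ (z₀ * s) := hpos _ (by positivity)
  rcases le_abs.1 hzη with h | h
  · have h1 := hgrowth (z₀ * s) ((z₀ + η) * s) (by nlinarith) (by nlinarith)
    rw [mul_div_mul_right _ _ hs.ne'] at h1
    have h2 : Λ ((z₀ + η) * s) ≤ Λ (z * s) :=
      hmono (Set.mem_Ici.2 (by positivity)) (Set.mem_Ici.2 (by positivity)) (by nlinarith)
    calc _ ≤ (u - 1) * Λ (z₀ * s) := mul_le_mul_of_nonneg_right (min_le_left _ _) hn
      _ ≤ Λ (z * s) - Λ (z₀ * s) := by linarith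
      _ ≤ _ := le_abs_self _
  · have h1 := hgrowth ((z₀ - η) * s) (z₀ * s) hX (by nlinarith)
    rw [mul_div_mul_right _ _ hs.ne'] at h1
    have h2 : Λ (z * s) ≤ Λ ((z₀ - η) * s) :=
      hmono (Set.mem_Ici.2 (by positivity)) (Set.mem_Ici.2 (by positivity)) (by nlinarith)
    have h3 : Λ ((z₀ - η) * s) ≤ v⁻¹ * Λ (z₀ * s) := by
      rw [inv_mul_eq_div, le_div_iff₀ (by linarith)]; linarith
    calc _ ≤ (1 - v⁻¹) * Λ (z₀ * s) := mul_le_mul_of_nonneg_right (min_le_right _ _) hn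
      _ ≤ -(Λ (z * s) - Λ (z₀ * s)) := by linarith
      _ ≤ _ := neg_le_abs _

/-- Comparison of the rescaled Poisson weight, multiplied by a function `M` with `M` and `z * M z`
bounded, with a multiple `l` of the pulled-back Gamma density. -/
lemma abs_poissonWeight_sub_le {Λ Λ' : ℝ → ℝ} (hpos : ∀ x, 0 ≤ x → 0 ≤ Λ x)
    (hmono : MonotoneOn Λ (Set.Ici (0 : ℝ)))
    (hderiv : ∀ x, 0 ≤ x → HasDerivAt Λ (Λ' x) x) {M : ℝ → ℝ} {B c l ε δ η s z₀ X₀ : ℝ} {m : ℕ}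
    (hB : 0 ≤ B) (hM : ∀ z, 0 < z → |M z| ≤ B) (hzM : ∀ z, 0 < z → |z * M z| ≤ B)
    (hc : 0 < c) (hε : 0 ≤ ε) (hδ : 0 < δ) (hs : 0 < s) (hX₀ : 0 < X₀) (hX₀s : X₀ ≤ (z₀ - η) * s)
    (hΛX : ∀ x, X₀ ≤ x → 0 < Λ x) (hq : ∀ x, X₀ ≤ x → c / 2 ≤ x * Λ' x / Λ x)
    (hnear : ∀ z x, |z - z₀| < η → X₀ ≤ x → |z * M z / (x * Λ' x / Λ x) - l| ≤ ε)
    (hfar : ∀ z, 0 < z → η ≤ |z - z₀| → δ * (m + 1) ≤ |Λ (z * s) - (m + 1)|)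
    {z : ℝ} (hz : 0 < z) :
    |((m : ℝ) + 1) * (exp (-Λ (z * s)) * Λ (z * s) ^ (m + 1) / ((m + 1).factorial : ℝ) * M z) -
        l * gammaPullback Λ Λ' s m z| ≤
      ε * gammaPullback Λ Λ' s m z +
        (2 * B / c + |l|) / δ ^ 2 / (m + 1) ^ 2 *
          ((Λ (z * s) - (m + 1)) ^ 2 * gammaPullback Λ Λ' s m z) +
        (Set.Ioc 0 (X₀ / s)).indicator (fun _ => B * (Λ X₀ * (Λ X₀ ^ m / m.factorial))) z := by
  set D := gammaPullback Λ Λ' s m z with hD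
  have hD0 : 0 ≤ D := gammaPullback_nonneg hpos hmono hderiv hs m hz.le
  have hzs : 0 < z * s := mul_pos hz hs
  have hΛ0 : 0 ≤ Λ (z * s) := hpos _ hzs.le
  have hC0 : 0 ≤ 2 * B / c + |l| := by positivity
  have hind : 0 ≤ (Set.Ioc 0 (X₀ / s)).indicator
      (fun _ => B * (Λ X₀ * (Λ X₀ ^ m / m.factorial))) z :=
    Set.indicator_nonneg (fun _ _ => by have := hpos X₀ hX₀.le; positivity) z
  have hfac : ((m : ℝ) + 1) *
      (exp (-Λ (z * s)) * Λ (z * s) ^ (m + 1) / ((m + 1).factorial : ℝ) * M z) =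
      exp (-Λ (z * s)) * (Λ (z * s) * (Λ (z * s) ^ m / m.factorial)) * M z := by
    rw [Nat.factorial_succ]
    push_cast
    field_simp
    ring
  have hcheb : η ≤ |z - z₀| →
      (2 * B / c + |l|) * D ≤ (2 * B / c + |l|) / δ ^ 2 / (m + 1) ^ 2 *
        ((Λ (z * s) - (m + 1)) ^ 2 * D) := by
    intro h
    have h2 : (δ * (m + 1)) ^ 2 ≤ (Λ (z * s) - (m + 1)) ^ 2 := by
      rw [← sq_abs (Λ (z * s) - (m + 1))]
      exact pow_le_pow_left₀ (by positivity) (hfar z hz h) 2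
    calc (2 * B / c + |l|) * D
        = (2 * B / c + |l|) / δ ^ 2 / (m + 1) ^ 2 * ((δ * (m + 1)) ^ 2 * D) := by field_simp
      _ ≤ _ := by gcongr
  rw [hfac]
  rcases le_or_gt (z * s) X₀ with hzX | hzX
  · have hmem : z ∈ Set.Ioc 0 (X₀ / s) := ⟨hz, (le_div_iff₀ hs).2 hzX⟩
    have hle : Λ (z * s) ≤ Λ X₀ := hmono hzs.le hX₀.le hzX
    have hη : η ≤ |z - z₀| := by
      have : z ≤ z₀ - η := le_of_mul_le_mul_right (hzX.trans hX₀s) hs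
      rw [abs_sub_comm]
      exact le_trans (by linarith) (le_abs_self _)
    have hL : 0 ≤ Λ X₀ := hΛ0.trans hle
    have hexp : exp (-Λ (z * s)) ≤ 1 := exp_le_one_iff.2 (by linarith)
    have h1 : |exp (-Λ (z * s)) * (Λ (z * s) * (Λ (z * s) ^ m / m.factorial)) * M z| ≤
        B * (Λ X₀ * (Λ X₀ ^ m / m.factorial)) := by
      rw [abs_mul, abs_of_nonneg (by positivity)]
      calc _ ≤ (1 * (Λ X₀ * (Λ X₀ ^ m / m.factorial))) * B := by
            gcongr
            exact hM z hz
        _ = _ := by ring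
    have h2 := hcheb hη
    have h3 : |l * D| ≤ (2 * B / c + |l|) * D := by
      rw [abs_mul, abs_of_nonneg hD0]
      have : 0 ≤ 2 * B / c := by positivity
      gcongr
      linarith
    rw [Set.indicator_of_mem hmem]
    refine (abs_sub _ _).trans ?_
    linarith [mul_nonneg hε hD0]
  · have hΛp := hΛX _ hzX.le
    have hqz := hq _ hzX.le
    have hqp : 0 < z * s * Λ' (z * s) / Λ (z * s) := (half_pos hc).trans_le hqz
    have hΛ' : Λ' (z * s) ≠ 0 := by
      intro h
      simp [h] at hqp
    have hrep : exp (-Λ (z * s)) * (Λ (z * s) * (Λ (z * s) ^ m / m.factorial)) * M z - l * D =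
        (z * M z / (z * s * Λ' (z * s) / Λ (z * s)) - l) * D := by
      rw [hD, gammaPullback]
      field_simp
    rw [hrep, abs_mul, abs_of_nonneg hD0]
    rcases lt_or_ge |z - z₀| η with hη | hη
    · have h1 := mul_le_mul_of_nonneg_right (hnear z _ hη hzX.le) hD0
      have h2 : 0 ≤ (2 * B / c + |l|) / δ ^ 2 / (m + 1) ^ 2 *
        ((Λ (z * s) - (m + 1)) ^ 2 * D) := by positivity
      linarith
    · have h1 : |z * M z / (z * s * Λ' (z * s) / Λ (z * s)) - l| ≤ 2 * B / c + |l| := by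
        refine (abs_sub _ _).trans ?_
        gcongr
        rw [abs_div, abs_of_pos hqp]
        calc _ ≤ B / (c / 2) := div_le_div₀ hB (hzM z hz) (half_pos hc) hqz
          _ = _ := by field_simp
      have h2 := mul_le_mul_of_nonneg_right h1 hD0
      linarith [hcheb hη, mul_nonneg hε hD0]

/-- Dynamical scaling for the fractional non-homogeneous Poisson process. -/
theorem fnhPp_dynamical_scaling
    (β : ℝ) (hβ0 : 0 < β) (hβ1 : β < 1)
    (Λ Λ' : ℝ → ℝ)
    (hΛmap : ∀ x, 0 ≤ x → 0 ≤ Λ x)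
    (hΛ0 : Λ 0 = 0)
    (hΛmono : MonotoneOn Λ (Set.Ici (0 : ℝ)))
    (hΛderiv : ∀ x, 0 ≤ x → HasDerivAt Λ (Λ' x) x)
    (hΛ'cont : ContinuousOn Λ' (Set.Ici (0 : ℝ)))
    (hΛinf : Tendsto Λ atTop atTop)
    (c : ℝ) (hc : 0 < c)
    (hΛasymp : (fun x => Λ' x / Λ x - c / x) =O[atTop] fun x => 1 / (x * Real.log x))
    (P : ℕ → ℝ → ℝ)
    (hP : ∀ (n : ℕ) (t : ℝ), 0 < t →
      P n t = ∫ z in Set.Ioi (0 : ℝ),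
        Real.exp (-Λ (z * t ^ β)) * (Λ (z * t ^ β)) ^ n / (Nat.factorial n : ℝ) * mWright β z)
    (z₀ : ℝ) (hz₀ : 0 < z₀)
    (n : ℕ → ℕ) (t : ℕ → ℝ)
    (hn : ∀ k, 0 < n k) (ht : ∀ k, 0 < t k)
    (hrel : ∀ k, (n k : ℝ) = Λ (z₀ * (t k) ^ β))
    (hninf : Tendsto (fun k => n k) atTop atTop) :
    Tendsto (fun k => (n k : ℝ) * P (n k) (t k)) atTop
      (nhds (z₀ / c * mWright β z₀)) := by
  obtain ⟨B, hB, hM, hzM, hMc⟩ := mWright_bounds hβ0 hβ1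
  have hs : ∀ k, 0 < t k ^ β := fun k => rpow_pos_of_pos (ht k) β
  have hnR : Tendsto (fun k => (n k : ℝ)) atTop atTop := tendsto_natCast_atTop_atTop.comp hninf
  have hsinf : Tendsto (fun k => t k ^ β) atTop atTop := by
    refine tendsto_atTop.2 fun S => ?_
    filter_upwards [hnR.eventually_gt_atTop (Λ (z₀ * |S|))] with k hk
    by_contra! h
    rw [hrel] at hk
    have h1 : z₀ * t k ^ β ≤ z₀ * |S| :=
      mul_le_mul_of_nonneg_left (h.le.trans (le_abs_self S)) hz₀.le
    exact absurd (hΛmono (Set.mem_Ici.2 (mul_pos hz₀ (hs k)).le)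
      (Set.mem_Ici.2 (by positivity)) h1) (not_le.2 hk)
  set l := z₀ / c * mWright β z₀ with hl
  refine Metric.tendsto_nhds.2 fun ε hε => ?_
  have hcont : ContinuousAt (fun p : ℝ × ℝ => p.1 * mWright β p.1 / p.2) (z₀, c) := by
    have h1 : ContinuousAt (fun p : ℝ × ℝ => mWright β p.1) (z₀, c) :=
      ContinuousAt.comp (f := Prod.fst) (x := (z₀, c))
        (hMc.continuousAt (Ioi_mem_nhds hz₀)) continuousAt_fst
    exact (continuousAt_fst.mul h1).div continuousAt_snd hc.ne'
  obtain ⟨η₁, hη₁, hη₁'⟩ := Metric.continuousAt_iff.1 hcont (ε / 2) (half_pos hε)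
  set η := min η₁ (z₀ / 2) with hη
  have hη0 : 0 < η := lt_min hη₁ (half_pos hz₀)
  have hηz : η < z₀ := (min_le_right _ _).trans_lt (half_lt_self hz₀)
  obtain ⟨X₀, hX₀⟩ := eventually_atTop.1
    ((((tendsto_mul_logDeriv_of_isBigO hΛasymp).eventually
      (Metric.ball_mem_nhds c (lt_min hη₁ (half_pos hc)))).and
      (hΛinf.eventually_gt_atTop 0)).and (eventually_gt_atTop 0))
  have hX₀0 : 0 < X₀ := (hX₀ X₀ le_rfl).2
  have hqd : ∀ x, X₀ ≤ x → |x * Λ' x / Λ x - c| < min η₁ (c / 2) := fun x hx =>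
    (hX₀ x hx).1.1
  have hΛX : ∀ x, X₀ ≤ x → 0 < Λ x := fun x hx => (hX₀ x hx).1.2
  have hq : ∀ x, X₀ ≤ x → c / 2 ≤ x * Λ' x / Λ x := fun x hx => by
    have := (abs_lt.1 ((hqd x hx).trans_le (min_le_right _ _))).1
    linarith
  have hgrowth : ∀ a b, X₀ ≤ a → a ≤ b → (b / a) ^ (c / 2) * Λ a ≤ Λ b := fun a b ha hab =>
    rpow_div_mul_le_of_le_logDeriv hX₀0 (fun x hx => hΛderiv x (hX₀0.le.trans hx))
      (fun x hx => (le_div_iff₀ (hΛX x hx)).1 (hq x hx)) ha hab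
  obtain ⟨δ, hδ, hsep⟩ := exists_mul_le_abs_sub (half_pos hc) hΛmap hΛmono hgrowth hη0 hηz
  have hnear : ∀ z x, |z - z₀| < η → X₀ ≤ x →
      |z * mWright β z / (x * Λ' x / Λ x) - l| ≤ ε / 2 := by
    intro z x hz hx
    have h := hη₁' (x := (z, x * Λ' x / Λ x)) (max_lt (hz.trans_le (min_le_left _ _))
      ((hqd x hx).trans_le (min_le_left _ _)))
    rw [Real.dist_eq] at h
    rw [hl, div_mul_eq_mul_div]
    exact h.le
  set L := Λ X₀
  have hrem : Tendsto (fun k => (2 * B / c + |l|) / δ ^ 2 / (n k : ℝ) +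
      X₀ / t k ^ β * (B * (L * (L ^ (n k - 1) / ((n k - 1).factorial : ℝ))))) atTop (nhds 0) := by
    have h1 := hnR.const_div_atTop ((2 * B / c + |l|) / δ ^ 2)
    have h2 := hsinf.const_div_atTop X₀
    have h3 := (((FloorSemiring.tendsto_pow_div_factorial_atTop L).comp
      ((tendsto_sub_atTop_nat 1).comp hninf)).const_mul L).const_mul B
    simpa using h1.add (h2.mul h3)
  filter_upwards [hrem.eventually (gt_mem_nhds (half_pos hε)),
    hsinf.eventually_ge_atTop (X₀ / (z₀ - η))] with k hk1 hk2
  have hX₀s : X₀ ≤ (z₀ - η) * t k ^ β := by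
    rw [mul_comm]
    exact (div_le_iff₀ (sub_pos.2 hηz)).1 hk2
  obtain ⟨m, hm⟩ := Nat.exists_eq_succ_of_ne_zero (hn k).ne'
  have hmR : (n k : ℝ) = m + 1 := by rw [hm]; push_cast; rfl
  have hsub : n k - 1 = m := by rw [hm]; rfl
  rw [hmR, hsub] at hk1
  have hfar : ∀ z, 0 < z → η ≤ |z - z₀| →
      δ * ((m : ℝ) + 1) ≤ |Λ (z * t k ^ β) - (m + 1)| := by
    intro z hz hzη
    have := hsep _ (hs k) hX₀s z hz hzη
    rwa [← hrel, hmR] at this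
  have hΛc : ContinuousOn (fun z => Λ (z * t k ^ β)) (Set.Ioi 0) := fun z hz => by
    have h1 := (hΛderiv (z * t k ^ β) (mul_pos hz (hs k)).le).continuousAt
    exact (ContinuousAt.comp (f := fun z => z * t k ^ β) (x := z) h1
      (by fun_prop)).continuousWithinAt
  have hmeas : AEStronglyMeasurable (fun z => ((m : ℝ) + 1) *
      (exp (-Λ (z * t k ^ β)) * Λ (z * t k ^ β) ^ (m + 1) / ((m + 1).factorial : ℝ) *
        mWright β z)) (volume.restrict (Set.Ioi 0)) := by
    exact (continuousOn_const.mul (((hΛc.neg.rexp.mul (hΛc.pow _)).div_const _).mul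
      hMc)).aestronglyMeasurable measurableSet_Ioi
  have hmain := abs_integral_sub_le_of_gammaPullback hΛmap hΛ0 hΛmono hΛderiv hΛinf (hs k) m
    (div_pos hX₀0 (hs k)).le hmeas fun z hz =>
      abs_poissonWeight_sub_le hΛmap hΛmono hΛderiv hB hM hzM hc (half_pos hε).le hδ (hs k)
        hX₀0 hX₀s hΛX hq hnear hfar hz
  rw [Real.dist_eq, hP _ _ (ht k), ← integral_const_mul, hmR, hm]
  linarith
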